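/- arXiv:1805.09797 — 9 statements merged into one kernel-verified Lean document; each statement's English description precedes it below -/
import Mathlib

section
/- Let n ≥ 1 and let m = (m_{i,j})_{1≤i≤j≤n} be nonnegative integers, extended by the convention m_{i,j} = 0 whenever the condition 1 ≤ i ≤ j ≤ n fails. Assume m_{i,j} = 0 whenever j − i ≥ 2. Then for every pair 1 ≤ i ≤ j ≤ n, the minimum, taken over all maps ν : [1,i]×[j,n] → [i,j] satisfying ν(k,l) ≤ ν(k',l') whenever k ≤ k' and l ≤ l', of the sum Σ_{(k,l)∈[1,i]×[j,n]} m_{ν(k,l)+k−i, ν(k,l)+l−j}, is equal to min_{i ≤ p ≤ q ≤ r ≤ j} ( m_{p−1,p} + m_{q,q} + m_{r,r+1} ). -/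
theorem sum_Icc_eq_two_bottom_terms (j n : ℕ) (hj : j ≤ n) (f : ℕ → ℕ)
    (hf : ∀ l, j + 2 ≤ l → f l = 0) :
    ∑ l ∈ Finset.Icc j n, f l = f j + if j < n then f (j + 1) else 0 := by
  split_ifs with h
  · rw [← Finset.sum_pair (f := f) (by omega : j ≠ j + 1)]
    symm
    apply Finset.sum_subset
    · intro l hl
      simp only [Finset.mem_insert, Finset.mem_singleton, Finset.mem_Icc] at hl ⊢
      omega
    · intro l hl hl'
      simp only [Finset.mem_insert, Finset.mem_singleton, Finset.mem_Icc] at hl hl'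
      exact hf l (by omega)
  · obtain rfl : j = n := by omega
    simp

theorem sum_Icc_eq_two_top_terms (i : ℕ) (hi : 1 ≤ i) (f : ℕ → ℕ)
    (hf : ∀ k, k + 2 ≤ i → f k = 0) :
    ∑ k ∈ Finset.Icc 1 i, f k = f i + if 1 < i then f (i - 1) else 0 := by
  split_ifs with h
  · rw [← Finset.sum_pair (f := f) (by omega : i ≠ i - 1)]
    symm
    apply Finset.sum_subset
    · intro l hl
      simp only [Finset.mem_insert, Finset.mem_singleton, Finset.mem_Icc] at hl ⊢
      omega
    · intro l hl hl'
      simp only [Finset.mem_insert, Finset.mem_singleton, Finset.mem_Icc] at hl hl'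
      exact hf l (by omega)
  · obtain rfl : i = 1 := by omega
    simp

/-- When `m` is supported on segments of length at most 2, at most three terms of the
Knight–Zelevinsky sum survive: those at `(i, j)`, `(i - 1, j)` and `(i, j + 1)`. -/
theorem knightZelevinsky_sum_eq (n : ℕ) (m : ℤ → ℤ → ℕ)
    (hm2 : ∀ i j : ℤ, 2 ≤ j - i → m i j = 0)
    (i j : ℕ) (hi : 1 ≤ i) (hj : j ≤ n) (ν : ℕ × ℕ → ℕ) :
    ∑ k ∈ Finset.Icc 1 i, ∑ l ∈ Finset.Icc j n,
        m ((ν (k, l) : ℤ) + k - i) ((ν (k, l) : ℤ) + l - j) =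
      (if 1 < i then m ((ν (i - 1, j) : ℤ) - 1) (ν (i - 1, j)) else 0)
        + m (ν (i, j)) (ν (i, j))
        + if j < n then m (ν (i, j + 1)) ((ν (i, j + 1) : ℤ) + 1) else 0 := by
  have inner (k : ℕ) (hk : k ≤ i) := sum_Icc_eq_two_bottom_terms j n hj
    (fun l => m ((ν (k, l) : ℤ) + k - i) ((ν (k, l) : ℤ) + l - j))
    (fun l hl => hm2 _ _ (by omega))
  rw [sum_Icc_eq_two_top_terms i hi, inner i le_rfl, inner (i - 1) (by omega)]
  · have h : m ((ν (i - 1, j + 1) : ℤ) + (i - 1 : ℕ) - i)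
        ((ν (i - 1, j + 1) : ℤ) + (j + 1 : ℕ) - j) = 0 := hm2 _ _ (by omega)
    have e₁ : (ν (i - 1, j) : ℤ) + (i - 1 : ℕ) - i = ν (i - 1, j) - 1 := by omega
    have e₂ : (ν (i, j + 1) : ℤ) + (j + 1 : ℕ) - j = ν (i, j + 1) + 1 := by omega
    simp only [h, e₁, e₂, add_sub_cancel_right, ite_self, add_zero]
    ring
  · intro k hk
    exact Finset.sum_eq_zero fun l hl =>
      hm2 _ _ (by have := (Finset.mem_Icc.mp hl).1; omega)


/-- Knight–Zelevinsky formula specialized to multi-segments supported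
on segments of length at most 2. The multi-segment `m` is given as a function
`ℤ → ℤ → ℕ`, vanishing outside the range `1 ≤ i ≤ j ≤ n` and on segments of
length `≥ 2`. -/
theorem stmt0 (n : ℕ) (hn : 1 ≤ n) (m : ℤ → ℤ → ℕ)
    (hm0 : ∀ i j : ℤ, ¬(1 ≤ i ∧ i ≤ j ∧ j ≤ (n : ℤ)) → m i j = 0)
    (hm2 : ∀ i j : ℤ, 2 ≤ j - i → m i j = 0)
    (i j : ℕ) (hi : 1 ≤ i) (hij : i ≤ j) (hj : j ≤ n) :
    sInf {s : ℕ | ∃ ν : ℕ × ℕ → ℕ,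
        (∀ k l : ℕ, 1 ≤ k → k ≤ i → j ≤ l → l ≤ n → i ≤ ν (k, l) ∧ ν (k, l) ≤ j) ∧
        (∀ k l k' l' : ℕ, 1 ≤ k → k ≤ k' → k' ≤ i → j ≤ l → l ≤ l' → l' ≤ n →
          ν (k, l) ≤ ν (k', l')) ∧
        s = ∑ k ∈ Finset.Icc 1 i, ∑ l ∈ Finset.Icc j n,
              m ((ν (k, l) : ℤ) + k - i) ((ν (k, l) : ℤ) + l - j)} =
    sInf {s : ℕ | ∃ p q r : ℕ, i ≤ p ∧ p ≤ q ∧ q ≤ r ∧ r ≤ j ∧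
        s = m ((p : ℤ) - 1) (p : ℤ) + m (q : ℤ) (q : ℤ) + m (r : ℤ) ((r : ℤ) + 1)} := by
  have hsum := knightZelevinsky_sum_eq n m hm2 i j hi hj
  apply le_antisymm
  · refine le_csInf ⟨_, i, i, i, le_rfl, le_rfl, le_rfl, hij, rfl⟩ ?_
    rintro _ ⟨p, q, r, hp, hpq, hqr, hr, rfl⟩
    let ν : ℕ × ℕ → ℕ := fun x => if j < x.2 then r else if x.1 < i then p else q
    refine le_trans (Nat.sInf_le ⟨ν, ?_, ?_, rfl⟩) ?_
    · intro k l _ _ _ _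
      simp only [ν]
      split_ifs <;> omega
    · intro k l k' l' _ _ _ _ _ _
      simp only [ν]
      split_ifs <;> omega
    · rw [hsum]
      have e₁ : 1 < i → ν (i - 1, j) = p := fun h => by simp [ν]; omega
      have e₂ : ν (i, j) = q := by simp [ν]
      have e₃ : ν (i, j + 1) = r := by simp [ν]
      rw [e₂, e₃]
      gcongr
      · split_ifs with h
        · rw [e₁ h]
        · exact Nat.zero_le _
      · split_ifs
        · rfl
        · exact Nat.zero_le _
  · refine le_csInf ⟨_, fun _ => i, fun _ _ _ _ _ _ => ⟨le_rfl, hij⟩,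
      fun _ _ _ _ _ _ _ _ _ _ => le_rfl, rfl⟩ ?_
    rintro _ ⟨ν, hν, hmono, rfl⟩
    apply Nat.sInf_le
    have hq := hν i j hi le_rfl le_rfl hj
    refine ⟨if 1 < i then ν (i - 1, j) else i, ν (i, j),
      if j < n then ν (i, j + 1) else j, ?_, ?_, ?_, ?_, ?_⟩
    · split_ifs with h
      · exact (hν _ _ (by omega) (by omega) le_rfl hj).1
      · exact le_rfl
    · split_ifs with h
      · exact hmono _ _ _ _ (by omega) (by omega) le_rfl le_rfl le_rfl hj
      · exact hq.1
    · split_ifs with h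
      · exact hmono _ _ _ _ hi le_rfl le_rfl le_rfl (by omega) (by omega)
      · exact hq.2
    · split_ifs with h
      · exact (hν _ _ hi le_rfl (by omega) (by omega)).2
      · exact le_rfl
    · rw [hsum]
      congr 1
      · congr 1
        split_ifs with h
        · rfl
        · exact (hm0 _ _ (by omega)).symm
      · split_ifs with h
        · rfl
        · exact (hm0 _ _ (by omega)).symm
end

section
/- Let n ≥ 1 and let x = (x_0, x_1, …, x_n) be nonnegative integers with x_0 = x_n = 0 and x_{k−1} + x_k ≤ n + 1 for all k = 1, …, n. Define the multi-segment x' by m_{k,k} = n + 1 − x_{k−1} − x_k for 1 ≤ k ≤ n, m_{k,k+1} = x_k for 1 ≤ k ≤ n−1, and m_{i,j} = 0 otherwise. Then for every pair 1 ≤ i ≤ j ≤ n, the minimum, taken over all maps ν : [1,i]×[j,n] → [i,j] satisfying ν(k,l) ≤ ν(k',l') whenever k ≤ k' and l ≤ l', of the sum Σ_{(k,l)∈[1,i]×[j,n]} m_{ν(k,l)+k−i, ν(k,l)+l−j} (with the convention m_{i,j} = 0 outside the range 1 ≤ i ≤ j ≤ n), equals n + 1 − max{ x_{l−1} + x_l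 − x_{k−1} − x_m : i ≤ k ≤ l ≤ m ≤ j }. -/
/-- Only three cells of a rectangle contribute to the double sum of a function vanishing elsewhere:
the corner `(i, j)` and its neighbours `(i - 1, j)` and `(i, j + 1)`. -/
theorem sum_Icc_Icc_eq_corner (F : ℕ → ℕ → ℕ) (i j n : ℕ) (hi : 1 ≤ i) (hj : j ≤ n)
    (hF : ∀ k l : ℕ, 1 ≤ k → k ≤ i → j ≤ l → l ≤ n → ¬(k = i ∧ l = j) →
      ¬(k = i - 1 ∧ l = j) → ¬(k = i ∧ l = j + 1) → F k l = 0) :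
    ∑ k ∈ Finset.Icc 1 i, ∑ l ∈ Finset.Icc j n, F k l =
      F i j + (if 2 ≤ i then F (i - 1) j else 0) + (if j < n then F i (j + 1) else 0) := by
  have key : ∀ p ∈ Finset.Icc 1 i ×ˢ Finset.Icc j n, F p.1 p.2 =
      (if p = (i, j) then F i j else 0) + (if p = (i - 1, j) then F (i - 1) j else 0) +
        (if p = (i, j + 1) then F i (j + 1) else 0) := by
    rintro ⟨k, l⟩ hp
    simp only [Finset.mem_product, Finset.mem_Icc] at hp
    simp only [Prod.mk.injEq]
    have := hF k l hp.1.1 hp.1.2 hp.2.1 hp.2.2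
    by_cases h1 : k = i ∧ l = j
    · obtain ⟨rfl, rfl⟩ := h1
      have h2 : ¬(k = k - 1) := by omega
      simp [h2]
    by_cases h2 : k = i - 1 ∧ l = j
    · obtain ⟨rfl, rfl⟩ := h2
      have h3 : ¬(i - 1 = i) := by omega
      simp [h3]
    by_cases h3 : k = i ∧ l = j + 1
    · obtain ⟨rfl, rfl⟩ := h3
      simp
    simp only [h1, h2, h3, if_false]
    exact this h1 h2 h3
  rw [← Finset.sum_product', Finset.sum_congr rfl key]
  simp only [Finset.sum_add_distrib, Finset.sum_ite_eq', Finset.mem_product, Finset.mem_Icc]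
  congr 1
  · congr 1
    · rw [if_pos (by omega)]
    · exact if_congr (by omega) rfl rfl
  · exact if_congr (by omega) rfl rfl


/-- the Knight–Zelevinsky formula applied to the multi-segment `x'`
associated to a tuple `x = (x_0, …, x_n)` of nonnegative integers with
`x_0 = x_n = 0` and `x_{k-1} + x_k ≤ n + 1`. -/
theorem stmt1 (n : ℕ) (hn : 1 ≤ n) (x : ℕ → ℕ)
    (hx0 : x 0 = 0) (hxn : x n = 0)
    (hxb : ∀ k : ℕ, 1 ≤ k → k ≤ n → x (k - 1) + x k ≤ n + 1)
    (m : ℤ → ℤ → ℕ)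
    (hmd : ∀ k : ℕ, 1 ≤ k → k ≤ n → m (k : ℤ) (k : ℤ) = n + 1 - x (k - 1) - x k)
    (hms : ∀ k : ℕ, 1 ≤ k → k ≤ n - 1 → m (k : ℤ) ((k : ℤ) + 1) = x k)
    (hm0 : ∀ i j : ℤ, ¬(∃ k : ℕ, 1 ≤ k ∧ k ≤ n ∧ i = (k : ℤ) ∧ j = (k : ℤ)) →
      ¬(∃ k : ℕ, 1 ≤ k ∧ k ≤ n - 1 ∧ i = (k : ℤ) ∧ j = (k : ℤ) + 1) → m i j = 0)
    (i j : ℕ) (hi : 1 ≤ i) (hij : i ≤ j) (hj : j ≤ n) :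
    ((sInf {s : ℕ | ∃ ν : ℕ × ℕ → ℕ,
        (∀ k l : ℕ, 1 ≤ k → k ≤ i → j ≤ l → l ≤ n → i ≤ ν (k, l) ∧ ν (k, l) ≤ j) ∧
        (∀ k l k' l' : ℕ, 1 ≤ k → k ≤ k' → k' ≤ i → j ≤ l → l ≤ l' → l' ≤ n →
          ν (k, l) ≤ ν (k', l')) ∧
        s = ∑ k ∈ Finset.Icc 1 i, ∑ l ∈ Finset.Icc j n,
              m ((ν (k, l) : ℤ) + k - i) ((ν (k, l) : ℤ) + l - j)} : ℕ) : ℤ) =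
    (n : ℤ) + 1 - sSup {t : ℤ | ∃ k l mm : ℕ, i ≤ k ∧ k ≤ l ∧ l ≤ mm ∧ mm ≤ j ∧
        t = (x (l - 1) : ℤ) + x l - x (k - 1) - x mm} := by
  have hsum : ∀ ν : ℕ × ℕ → ℕ,
      (∀ k l : ℕ, 1 ≤ k → k ≤ i → j ≤ l → l ≤ n → i ≤ ν (k, l) ∧ ν (k, l) ≤ j) →
      ∑ k ∈ Finset.Icc 1 i, ∑ l ∈ Finset.Icc j n,
        m ((ν (k, l) : ℤ) + k - i) ((ν (k, l) : ℤ) + l - j) =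
      (n + 1 - x (ν (i, j) - 1) - x (ν (i, j))) +
        (if 2 ≤ i then x (ν (i - 1, j) - 1) else 0) +
        (if j < n then x (ν (i, j + 1)) else 0) := by
    intro ν hν
    rw [sum_Icc_Icc_eq_corner
      (fun k l => m ((ν (k, l) : ℤ) + k - i) ((ν (k, l) : ℤ) + l - j)) i j n hi hj]
    · congr 1
      · congr 1
        · have h := hν i j hi le_rfl le_rfl hj
          rw [← hmd _ (by omega) (by omega)]
          congr 1 <;> ring
        · split_ifs with h2
          · have h := hν (i - 1) j (by omega) (by omega) le_rfl hj
            rw [← hms _ (by omega) (by omega)]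
            congr 1 <;> omega
          · rfl
      · split_ifs with h2
        · have h := hν i (j + 1) hi le_rfl (by omega) h2
          rw [← hms _ (by omega) (by omega)]
          congr 1 <;> omega
        · rfl
    · intro k l _ _ _ _ h1 h2 h3
      apply hm0
      · rintro ⟨q, hq⟩
        omega
      · rintro ⟨q, hq⟩
        omega
  set T : Set ℤ := {t : ℤ | ∃ k l mm : ℕ, i ≤ k ∧ k ≤ l ∧ l ≤ mm ∧ mm ≤ j ∧
        t = (x (l - 1) : ℤ) + x l - x (k - 1) - x mm} with hT
  have hTne : T.Nonempty := ⟨_, i, i, i, le_rfl, le_rfl, le_rfl, hij, rfl⟩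
  have hTbdd : BddAbove T := by
    refine ⟨n + 1, ?_⟩
    rintro t ⟨k, l, mm, h1, h2, h3, h4, rfl⟩
    have := hxb l (by omega) (by omega)
    omega
  set S : Set ℕ := {s : ℕ | ∃ ν : ℕ × ℕ → ℕ,
        (∀ k l : ℕ, 1 ≤ k → k ≤ i → j ≤ l → l ≤ n → i ≤ ν (k, l) ∧ ν (k, l) ≤ j) ∧
        (∀ k l k' l' : ℕ, 1 ≤ k → k ≤ k' → k' ≤ i → j ≤ l → l ≤ l' → l' ≤ n →
          ν (k, l) ≤ ν (k', l')) ∧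
        s = ∑ k ∈ Finset.Icc 1 i, ∑ l ∈ Finset.Icc j n,
              m ((ν (k, l) : ℤ) + k - i) ((ν (k, l) : ℤ) + l - j)} with hS
  have hSne : S.Nonempty :=
    ⟨_, fun _ => i, fun _ _ _ _ _ _ => ⟨le_rfl, hij⟩, fun _ _ _ _ _ _ _ _ _ _ => le_rfl, rfl⟩
  apply le_antisymm
  · obtain ⟨k, l, mm, h1, h2, h3, h4, ht⟩ := Int.csSup_mem hTne hTbdd
    rw [ht]
    let ν : ℕ × ℕ → ℕ := fun p => if p.1 < i then k else if p.2 = j then l else mm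
    have hν : ∀ k l : ℕ, 1 ≤ k → k ≤ i → j ≤ l → l ≤ n → i ≤ ν (k, l) ∧ ν (k, l) ≤ j := by
      intro p q _ _ _ _
      simp only [ν]
      split_ifs <;> omega
    have hle : sInf S ≤ _ := Nat.sInf_le ⟨ν, hν, by
      intro p q p' q' _ _ _ _ _ _
      simp only [ν]
      split_ifs <;> omega, rfl⟩
    rw [hsum ν hν] at hle
    have e1 : ν (i, j) = l := by simp [ν]
    have e2 : 2 ≤ i → ν (i - 1, j) = k := fun h => if_pos (show i - 1 < i by omega)
    have e3 : ν (i, j + 1) = mm := by simp [ν]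
    have hb := hxb l (by omega) (by omega)
    rw [e1, e3] at hle
    split_ifs at hle with c1 c2 c2
    · rw [e2 c1] at hle
      omega
    · rw [e2 c1] at hle
      omega
    · omega
    · omega
  · obtain ⟨ν, hν, hmono, hs⟩ := Nat.sInf_mem hSne
    rw [hs, hsum ν hν]
    have ha := hν i j hi le_rfl le_rfl hj
    have hb := hxb (ν (i, j)) (by omega) (by omega)
    obtain ⟨k, hk1, hk2, hk⟩ : ∃ k, i ≤ k ∧ k ≤ ν (i, j) ∧
        (if 2 ≤ i then x (ν (i - 1, j) - 1) else 0) = x (k - 1) := by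
      split_ifs with h
      · exact ⟨_, (hν (i - 1) j (by omega) (by omega) le_rfl hj).1,
          hmono _ _ _ _ (by omega) (by omega) le_rfl le_rfl le_rfl hj, rfl⟩
      · exact ⟨1, by omega, by omega, hx0.symm⟩
    obtain ⟨c, hc1, hc2, hc⟩ : ∃ c, ν (i, j) ≤ c ∧ c ≤ j ∧
        (if j < n then x (ν (i, j + 1)) else 0) = x c := by
      split_ifs with h
      · exact ⟨_, hmono _ _ _ _ hi le_rfl le_rfl le_rfl (by omega) h,
          (hν i (j + 1) hi le_rfl (by omega) h).2, rfl⟩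
      · obtain rfl : j = n := by omega
        exact ⟨j, ha.2, le_rfl, hxn.symm⟩
    rw [hk, hc]
    have := le_csSup hTbdd (show _ ∈ T from ⟨k, ν (i, j), c, hk1, hk2, hc1, hc2, rfl⟩)
    omega
end

section
/- Let n ≥ 1 and let x = (x_0, x_1, …, x_n) be a Motzkin path of length n. Then for every pair 1 ≤ i ≤ j ≤ n, one has max{ x_{l−1} + x_l − x_{k−1} − x_m : i ≤ k ≤ l ≤ m ≤ j } ≤ j − i; equivalently, the rank tuple r(x) satisfies r(x)_{ij} ≥ n + 1 + i − j componentwise, i.e. r(x) ≥ r¹ where r¹ is the rank tuple r¹_{ij} = n + 1 + i − j. -/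
/-- A sequence whose first `n` steps have absolute value at most one changes by at most `b - a`
between the positions `a ≤ b ≤ n`. -/
theorem abs_sub_le_of_forall_abs_step_le_one {n : ℕ} {x : ℕ → ℤ}
    (hx : ∀ i : ℕ, 1 ≤ i → i ≤ n → |x i - x (i - 1)| ≤ 1)
    {a b : ℕ} (hab : a ≤ b) (hb : b ≤ n) : |x b - x a| ≤ (b : ℤ) - a := by
  induction b, hab using Nat.le_induction with
  | base => simp
  | succ b hab ih =>
    have hstep := hx (b + 1) (by omega) hb
    have ih := ih (by omega)
    rw [Nat.add_sub_cancel] at hstep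
    rw [abs_le] at *
    push_cast
    omega


/-- for a Motzkin path `x` of length `n` and `1 ≤ i ≤ j ≤ n`, the
maximum of `x_{l-1} + x_l - x_{k-1} - x_m` over `i ≤ k ≤ l ≤ m ≤ j` is at most
`j - i`; equivalently, the rank tuple `r(x)_{ij} = n + 1 - max{...}` satisfies
`r(x)_{ij} ≥ n + 1 + i - j`, i.e. `r(x) ≥ r¹` componentwise. -/
theorem stmt4 (n : ℕ) (hn : 1 ≤ n) (x : ℕ → ℕ)
    (hx0 : x 0 = 0) (hxn : x n = 0)
    (hmotzkin : ∀ i : ℕ, 1 ≤ i → i ≤ n → |(x i : ℤ) - x (i - 1)| ≤ 1)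
    (i j : ℕ) (hi : 1 ≤ i) (hij : i ≤ j) (hj : j ≤ n) :
    sSup {t : ℤ | ∃ k l m : ℕ, i ≤ k ∧ k ≤ l ∧ l ≤ m ∧ m ≤ j ∧
        t = (x (l - 1) : ℤ) + x l - x (k - 1) - x m} ≤ (j : ℤ) - i ∧
    (n : ℤ) + 1 + i - j ≤
      (n : ℤ) + 1 - sSup {t : ℤ | ∃ k l m : ℕ, i ≤ k ∧ k ≤ l ∧ l ≤ m ∧ m ≤ j ∧
        t = (x (l - 1) : ℤ) + x l - x (k - 1) - x m} := by
  have hsup : sSup {t : ℤ | ∃ k l m : ℕ, i ≤ k ∧ k ≤ l ∧ l ≤ m ∧ m ≤ j ∧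
      t = (x (l - 1) : ℤ) + x l - x (k - 1) - x m} ≤ (j : ℤ) - i := by
    refine csSup_le ⟨_, i, i, i, le_rfl, le_rfl, le_rfl, hij, rfl⟩ ?_
    rintro t ⟨k, l, m, hik, hkl, hlm, hmj, rfl⟩
    have hleft := abs_sub_le_of_forall_abs_step_le_one (x := fun p => (x p : ℤ)) hmotzkin
      (Nat.sub_le_sub_right hkl 1) (by omega)
    have hright := abs_sub_le_of_forall_abs_step_le_one (x := fun p => (x p : ℤ)) hmotzkin
      hlm (hmj.trans hj)
    rw [abs_le] at hleft hright
    omega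
  exact ⟨hsup, by linarith⟩
end

section
/- Let n ≥ 1, let y = (y_0, y_1, …, y_n) be a Motzkin path of length n, and let z_1, …, z_{n−1} be integers with z_k ≥ y_k for all k = 1, …, n−1, with the convention z_0 = z_n = 0. Then Σ_{k=1}^{n−1} (z_k − y_k)(z_k − z_{k+1} + y_k − y_{k−1} + 2) ≥ 0. -/
/-- for a Motzkin path `y` of length `n` and integers `z_k ≥ y_k`
(with conventions `z_0 = z_n = 0`), the sum
`Σ_{k=1}^{n-1} (z_k - y_k)(z_k - z_{k+1} + y_k - y_{k-1} + 2)` is nonnegative. -/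
theorem stmt7 (n : ℕ) (hn : 1 ≤ n) (y : ℕ → ℕ)
    (hy0 : y 0 = 0) (hyn : y n = 0)
    (hmotzkin : ∀ i : ℕ, 1 ≤ i → i ≤ n → |(y i : ℤ) - y (i - 1)| ≤ 1)
    (z : ℕ → ℤ) (hz0 : z 0 = 0) (hzn : z n = 0)
    (hzy : ∀ k : ℕ, 1 ≤ k → k ≤ n - 1 → (y k : ℤ) ≤ z k) :
    0 ≤ ∑ k ∈ Finset.Icc 1 (n - 1),
        (z k - (y k : ℤ)) * (z k - z (k + 1) + (y k : ℤ) - (y (k - 1) : ℤ) + 2) := by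
  have partial_sum_bound : ∀ m ≤ n - 1, (z 1 - y 1) ^ 2 - (z (m + 1) - y (m + 1)) ^ 2 ≤
      2 * ∑ k ∈ Finset.Icc 1 m,
        (z k - (y k : ℤ)) * (z k - z (k + 1) + (y k : ℤ) - (y (k - 1) : ℤ) + 2) := by
    intro m
    induction m with
    | zero => simp
    | succ m ih =>
      intro hm
      have hsum := ih (by omega)
      rw [Finset.sum_Icc_succ_top (by omega)]
      have hleft := abs_le.mp (hmotzkin (m + 1) (by omega) (by omega))
      have hright := abs_le.mp (hmotzkin (m + 1 + 1) (by omega) (by omega))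
      have hz := hzy (m + 1) (by omega) hm
      simp only [Nat.add_sub_cancel] at hleft hright ⊢
      have hcurv : (0 : ℤ) ≤ (z (m + 1) - y (m + 1)) *
          (2 + 2 * (y (m + 1) : ℤ) - y (m + 1 + 1) - y m) :=
        mul_nonneg (by linarith) (by linarith [hleft.1, hright.2])
      linarith [sq_nonneg ((z (m + 1) - (y (m + 1) : ℤ)) - (z (m + 1 + 1) - y (m + 1 + 1)))]
  have h := partial_sum_bound (n - 1) le_rfl
  rw [Nat.sub_add_cancel hn, hzn, hyn, Nat.cast_zero] at h
  linarith [sq_nonneg (z 1 - (y 1 : ℤ))]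
end

section
/- Let n ≥ 1, let y = (y_0, y_1, …, y_n) be a Motzkin path of length n, and let z_1, …, z_{n−1} be integers with z_k ≥ y_k for all k = 1, …, n−1, with the convention z_0 = z_n = 0. Define D(y) = Σ_{k=1}^{n} (k − y_k)(n + 1 − k − y_{k−1}) − Σ_{k=1}^{n−1} (k − y_k)(n − k − y_k), and similarly D(z). Then D(y) ≥ D(z). -/
/-- The degree `D(x)` written as a single sum, for `x n = 0`. -/
theorem degree_eq_sum (n : ℕ) (hn : 1 ≤ n) (x : ℕ → ℤ) (hxn : x n = 0) :
    (∑ k ∈ Finset.Icc 1 n, ((k : ℤ) - x k) * ((n : ℤ) + 1 - k - x (k - 1))) -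
      (∑ k ∈ Finset.Icc 1 (n - 1), ((k : ℤ) - x k) * ((n : ℤ) - k - x k)) =
    ∑ k ∈ Finset.Icc 1 n, ((k : ℤ) - x k) * (1 + x k - x (k - 1)) := by
  have extend : ∑ k ∈ Finset.Icc 1 (n - 1), ((k : ℤ) - x k) * ((n : ℤ) - k - x k) =
      ∑ k ∈ Finset.Icc 1 n, ((k : ℤ) - x k) * ((n : ℤ) - k - x k) := by
    obtain ⟨m, rfl⟩ := Nat.exists_eq_add_of_le' hn
    rw [Finset.sum_Icc_succ_top (by omega), hxn]
    simp
  rw [extend, ← Finset.sum_sub_distrib]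
  exact Finset.sum_congr rfl fun k _ => by ring

/-- Partial sums of the degree differ by at most a boundary term when `y ≤ z` and `y` has steps
of size at most one. -/
theorem two_mul_sum_sub_le (m : ℕ) (y z : ℕ → ℤ) (hy0 : y 0 = 0) (hz0 : z 0 = 0)
    (hstep : ∀ i, 1 ≤ i → i ≤ m → |y i - y (i - 1)| ≤ 1) (hyz : ∀ k ≤ m, y k ≤ z k) :
    2 * ((∑ k ∈ Finset.Icc 1 m, ((k : ℤ) - z k) * (1 + z k - z (k - 1))) -
      ∑ k ∈ Finset.Icc 1 m, ((k : ℤ) - y k) * (1 + y k - y (k - 1))) ≤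
    (2 * m * z m - z m ^ 2) - (2 * m * y m - y m ^ 2) := by
  induction m with
  | zero => simp [hy0, hz0]
  | succ m ih =>
    have prev := ih (fun i h1 h2 => hstep i h1 (by omega)) fun k hk => hyz k (by omega)
    obtain ⟨lower, upper⟩ := abs_le.mp (hstep (m + 1) (by omega) le_rfl)
    have hm := hyz m (by omega)
    have hm' := hyz (m + 1) le_rfl
    rw [Finset.sum_Icc_succ_top (by omega), Finset.sum_Icc_succ_top (by omega)]
    simp only [Nat.add_sub_cancel] at lower upper ⊢
    push_cast
    nlinarith [sq_nonneg ((z (m + 1) - y (m + 1)) - (z m - y m)),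
      mul_nonneg (sub_nonneg.2 hm') (by linarith : 0 ≤ 1 + (y (m + 1) - y m)),
      mul_nonneg (sub_nonneg.2 hm) (by linarith : 0 ≤ 1 - (y (m + 1) - y m))]


/-- for a Motzkin path `y` of length `n` and integers `z_k ≥ y_k`
(with conventions `z_0 = z_n = 0`), the degree `D(y)` dominates `D(z)`, where
`D(y) = Σ_{k=1}^{n} (k - y_k)(n + 1 - k - y_{k-1}) - Σ_{k=1}^{n-1} (k - y_k)(n - k - y_k)`. -/
theorem stmt8 (n : ℕ) (hn : 1 ≤ n) (y : ℕ → ℕ)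
    (hy0 : y 0 = 0) (hyn : y n = 0)
    (hmotzkin : ∀ i : ℕ, 1 ≤ i → i ≤ n → |(y i : ℤ) - y (i - 1)| ≤ 1)
    (z : ℕ → ℤ) (hz0 : z 0 = 0) (hzn : z n = 0)
    (hzy : ∀ k : ℕ, 1 ≤ k → k ≤ n - 1 → (y k : ℤ) ≤ z k) :
    (∑ k ∈ Finset.Icc 1 n, ((k : ℤ) - z k) * ((n : ℤ) + 1 - k - z (k - 1))) -
      (∑ k ∈ Finset.Icc 1 (n - 1), ((k : ℤ) - z k) * ((n : ℤ) - k - z k)) ≤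
    (∑ k ∈ Finset.Icc 1 n, ((k : ℤ) - (y k : ℤ)) * ((n : ℤ) + 1 - k - (y (k - 1) : ℤ))) -
      (∑ k ∈ Finset.Icc 1 (n - 1), ((k : ℤ) - (y k : ℤ)) * ((n : ℤ) - k - (y k : ℤ))) := by
  have hyz : ∀ k ≤ n, (y k : ℤ) ≤ z k := by
    intro k hk
    rcases Nat.eq_zero_or_pos k with rfl | hpos
    · simp [hy0, hz0]
    rcases hk.eq_or_lt with rfl | hlt
    · simp [hyn, hzn]
    · exact hzy k hpos (by omega)
  have bound := two_mul_sum_sub_le n (fun k => (y k : ℤ)) z (by simp [hy0]) hz0 hmotzkin hyz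
  rw [degree_eq_sum n hn z hzn, degree_eq_sum n hn (fun k => (y k : ℤ)) (by simp [hyn])]
  simp only [hyn, hzn] at bound
  norm_num at bound
  linarith
end

section
/- Let n ≥ 2. The number of Motzkin paths x = (x_0, …, x_n) of length n having a single peak — that is, such that there exists p with 1 ≤ p ≤ n − 1 satisfying x_{s−1} ≤ x_s for all s with 1 ≤ s ≤ p and x_t ≥ x_{t+1} for all t with p ≤ t ≤ n − 1 — is exactly 2^{n−1}. -/
/-- The number of elements of `T` below `i`. -/
def stepCount (T : Finset ℕ) (i : ℕ) : ℕ := Nat.count (· ∈ T) i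

theorem stepCount_zero (T : Finset ℕ) : stepCount T 0 = 0 := Nat.count_zero _

theorem stepCount_succ (T : Finset ℕ) (i : ℕ) :
    stepCount T (i + 1) = stepCount T i + if i ∈ T then 1 else 0 := Nat.count_succ _ _

theorem stepCount_mono (T : Finset ℕ) : Monotone (stepCount T) := Nat.count_monotone _

/-- The single-peak path of length `n` whose level changes among the first `n - 1` steps occur
exactly at the steps in `T`; the last step is determined by the parity of their number. -/
def singlePeakPath (n : ℕ) (T : Finset ℕ) (i : ℕ) : ℕ :=
  if i < n then min (stepCount T i) (2 * ((stepCount T (n - 1) + 1) / 2) - stepCount T i) else 0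

theorem abs_singlePeakPath_succ_sub_le (n : ℕ) (T : Finset ℕ) {i : ℕ} (hi : i < n) :
    |(singlePeakPath n T (i + 1) : ℤ) - singlePeakPath n T i| ≤ 1 := by
  have h1 := stepCount_succ T i
  have h2 : i + 1 = n → stepCount T (n - 1) = stepCount T i := by rintro rfl; rfl
  rw [abs_le]
  unfold singlePeakPath
  split_ifs at * <;> omega

theorem exists_peak_singlePeakPath {n : ℕ} (hn : 2 ≤ n) (T : Finset ℕ) :
    ∃ p : ℕ, 1 ≤ p ∧ p ≤ n - 1 ∧
      (∀ s : ℕ, 1 ≤ s → s ≤ p → singlePeakPath n T (s - 1) ≤ singlePeakPath n T s) ∧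
      (∀ t : ℕ, p ≤ t → t ≤ n - 1 → singlePeakPath n T (t + 1) ≤ singlePeakPath n T t) := by
  classical
  have hex : ∃ p, 1 ≤ p ∧ (stepCount T (n - 1) + 1) / 2 ≤ stepCount T p :=
    ⟨n - 1, by omega, by omega⟩
  obtain ⟨hp1, hp⟩ := Nat.find_spec hex
  have hpn : Nat.find hex ≤ n - 1 := Nat.find_min' hex ⟨by omega, by omega⟩
  have hmin : ∀ s, s < Nat.find hex →
      s = 0 ∨ stepCount T s < (stepCount T (n - 1) + 1) / 2 := fun s hs => by
    have := Nat.find_min hex hs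
    omega
  refine ⟨Nat.find hex, hp1, hpn, fun s hs hsp => ?_, fun t hpt htn => ?_⟩
  · obtain ⟨s, rfl⟩ := Nat.exists_eq_add_of_le' hs
    have h1 := stepCount_succ T s
    have h2 := stepCount_mono T (hsp.trans hpn)
    have h0 : s = 0 → stepCount T s = 0 := by rintro rfl; exact stepCount_zero T
    have h3 := hmin s hsp
    simp only [singlePeakPath, Nat.add_sub_cancel]
    split_ifs at * <;> omega
  · have h1 := stepCount_mono T (Nat.le_succ t)
    have h2 := stepCount_mono T hpt
    simp only [singlePeakPath, Nat.succ_eq_add_one] at *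
    split_ifs <;> omega

theorem singlePeakPath_succ_ne_iff (n : ℕ) (T : Finset ℕ) {i : ℕ} (hi : i + 1 < n) :
    singlePeakPath n T (i + 1) ≠ singlePeakPath n T i ↔ i ∈ T := by
  have h1 := stepCount_succ T i
  have h2 := stepCount_mono T (show i + 1 ≤ n - 1 by omega)
  simp only [singlePeakPath, hi, (Nat.lt_succ_self i).trans hi, if_true]
  split_ifs at h1 with h <;> simp only [h, iff_true, iff_false] <;> omega

theorem singlePeakPath_filter_eq {n p : ℕ} {x : ℕ → ℕ} (h0 : x 0 = 0) (hx : ∀ i, n ≤ i → x i = 0)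
    (hstep : ∀ i, i < n → |(x (i + 1) : ℤ) - x i| ≤ 1) (hpn : p ≤ n - 1)
    (hup : ∀ s, s < p → x s ≤ x (s + 1))
    (hdown : ∀ t, p ≤ t → t ≤ n - 1 → x (t + 1) ≤ x t) :
    singlePeakPath n {i ∈ Finset.range (n - 1) | x (i + 1) ≠ x i} = x := by
  set T := {i ∈ Finset.range (n - 1) | x (i + 1) ≠ x i} with hT
  have hc : ∀ i, i < n - 1 →
      stepCount T (i + 1) = stepCount T i + if x (i + 1) ≠ x i then 1 else 0 := fun i hi => by
    simp [stepCount_succ, hT, hi]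
  have hleft : ∀ i, i ≤ p → stepCount T i = x i := by
    intro i
    induction i with
    | zero => intro _; rw [stepCount_zero, h0]
    | succ i ih =>
      intro hi
      have h1 := hc i (by omega)
      have h2 := abs_le.mp (hstep i (by omega))
      have h3 := hup i hi
      have h4 := ih (by omega)
      split_ifs at h1 <;> omega
  have hright : ∀ i, p ≤ i → i ≤ n - 1 → stepCount T i + x i = 2 * x p := by
    intro i hi
    induction i, hi using Nat.le_induction with
    | base => intro _; rw [hleft p le_rfl]; omega
    | succ i hpi ih =>
      intro hi
      have h1 := hc i (by omega)
      have h2 := abs_le.mp (hstep i (by omega))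
      have h3 := hdown i hpi (by omega)
      have h4 := ih (by omega)
      split_ifs at h1 <;> omega
  have hmono : ∀ i, i ≤ p → x i ≤ x p := fun i hi => by
    rw [← hleft i hi, ← hleft p le_rfl]; exact stepCount_mono T hi
  have hanti : ∀ i, p ≤ i → i ≤ n - 1 → x i ≤ x p := fun i hi hin => by
    have h1 := hright i hi hin
    have h2 := stepCount_mono T hi
    rw [hleft p le_rfl] at h2
    omega
  funext i
  unfold singlePeakPath
  split_ifs with hi
  · have h1 := hright (n - 1) hpn le_rfl
    have h2 := abs_le.mp (hstep (n - 1) (by omega))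
    rw [hx (n - 1 + 1) (by omega)] at h2
    rcases le_total i p with hip | hip
    · have h3 := hleft i hip
      have h4 := hmono i hip
      omega
    · have h3 := hright i hip (by omega)
      have h4 := hanti i hip (by omega)
      omega
  · exact (hx i (by omega)).symm


/-- the number of single-peak Motzkin paths of length `n` is `2^{n-1}`.
A path is encoded as a function `x : ℕ → ℕ` with `x 0 = 0` and `x i = 0` for
`i ≥ n` (so that the encoding is finite-to-one onto tuples `(x_0, …, x_n)`). -/
theorem stmt9 (n : ℕ) (hn : 2 ≤ n) :
    {x : ℕ → ℕ | x 0 = 0 ∧ (∀ i : ℕ, n ≤ i → x i = 0) ∧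
      (∀ i : ℕ, 1 ≤ i → i ≤ n → |(x i : ℤ) - x (i - 1)| ≤ 1) ∧
      ∃ p : ℕ, 1 ≤ p ∧ p ≤ n - 1 ∧
        (∀ s : ℕ, 1 ≤ s → s ≤ p → x (s - 1) ≤ x s) ∧
        (∀ t : ℕ, p ≤ t → t ≤ n - 1 → x (t + 1) ≤ x t)}.ncard = 2 ^ (n - 1) := by
  have hcard : (↑(Finset.range (n - 1)).powerset : Set (Finset ℕ)).ncard = 2 ^ (n - 1) := by
    rw [Set.ncard_coe_finset, Finset.card_powerset, Finset.card_range]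
  rw [← hcard]
  symm
  refine Set.ncard_congr (fun T _ => singlePeakPath n T) ?_ ?_ ?_
  · intro T _
    refine ⟨?_, ?_, ?_, exists_peak_singlePeakPath hn T⟩
    · simp [singlePeakPath, stepCount_zero]
    · intro i hi
      simp [singlePeakPath, hi]
    · intro i hi hin
      obtain ⟨i, rfl⟩ := Nat.exists_eq_add_of_le' hi
      exact abs_singlePeakPath_succ_sub_le n T hin
  · intro S T hS hT hST
    rw [Finset.mem_coe, Finset.mem_powerset] at hS hT
    ext i
    by_cases hi : i + 1 < n
    · rw [← singlePeakPath_succ_ne_iff n S hi, ← singlePeakPath_succ_ne_iff n T hi]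
      exact iff_of_eq (congrArg (fun x : ℕ → ℕ => x (i + 1) ≠ x i) hST)
    · refine iff_of_false (fun h => ?_) (fun h => ?_)
      · have := Finset.mem_range.mp (hS h)
        omega
      · have := Finset.mem_range.mp (hT h)
        omega
  · rintro x ⟨h0, hx, hstep, p, -, hpn, hup, hdown⟩
    refine ⟨{i ∈ Finset.range (n - 1) | x (i + 1) ≠ x i}, ?_, ?_⟩
    · exact Finset.mem_coe.mpr (Finset.mem_powerset.mpr (Finset.filter_subset _ _))
    · exact singlePeakPath_filter_eq h0 hx (fun i hi => hstep (i + 1) (by omega) hi) hpn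
        (fun s hs => hup (s + 1) (by omega) hs) hdown
end

section
/- Let n ≥ 1 and let x = (x_0, …, x_n) be a single-peak Motzkin path of length n, i.e. a Motzkin path admitting p with 1 ≤ p ≤ n − 1 such that x_{s−1} ≤ x_s for 1 ≤ s ≤ p and x_t ≥ x_{t+1} for p ≤ t ≤ n − 1. Define r(x)_{ij} = n + 1 − max{ x_{l−1} + x_l − x_{k−1} − x_m : i ≤ k ≤ l ≤ m ≤ j } for 1 ≤ i ≤ j ≤ n. Then: (a) r(x)_{k,k+1} ∈ {n, n+1} for every 1 ≤ k ≤ n − 1; and (b) for every 1 ≤ i ≤ j ≤ n with j − i ≥ 2, r(x)_{ij} = n + 1 − #{ k : i ≤ k ≤ j − 1 and r(x)_{k,k+1} = n }. -/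
/-- The rank tuple associated to a tuple `x`:
`r(x)_{ij} = n + 1 - max{ x_{l-1} + x_l - x_{k-1} - x_m : i ≤ k ≤ l ≤ m ≤ j }`. -/
noncomputable def rnk (n : ℕ) (x : ℕ → ℕ) (i j : ℕ) : ℤ :=
  (n : ℤ) + 1 - sSup {t : ℤ | ∃ k l m : ℕ, i ≤ k ∧ k ≤ l ∧ l ≤ m ∧ m ≤ j ∧
    t = (x (l - 1) : ℤ) + x l - x (k - 1) - x m}

/-- The larger of the up-step into `s` and the down-step out of `s`, truncated at `0`. -/
def localRise (x : ℕ → ℕ) (s : ℕ) : ℤ :=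
  max 0 (max ((x s : ℤ) - x (s - 1)) ((x s : ℤ) - x (s + 1)))

theorem localRise_nonneg (x : ℕ → ℕ) (s : ℕ) : 0 ≤ localRise x s :=
  le_max_left _ _

theorem sum_Ico_sub_pred (x : ℕ → ℕ) {k l : ℕ} (hkl : k ≤ l) :
    ∑ s ∈ Finset.Ico k l, ((x s : ℤ) - x (s - 1)) = (x (l - 1) : ℤ) - x (k - 1) := by
  induction l, hkl using Nat.le_induction with
  | base => simp
  | succ l hl ih =>
    rw [Finset.sum_Ico_succ_top hl, ih, Nat.add_sub_cancel]
    ring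

theorem sum_Ico_sub_succ (x : ℕ → ℕ) {l m : ℕ} (hlm : l ≤ m) :
    ∑ s ∈ Finset.Ico l m, ((x s : ℤ) - x (s + 1)) = (x l : ℤ) - x m := by
  induction m, hlm using Nat.le_induction with
  | base => simp
  | succ m hm ih =>
    rw [Finset.sum_Ico_succ_top hm, ih]
    ring

theorem le_sum_localRise (x : ℕ → ℕ) {i j k l m : ℕ} (hik : i ≤ k) (hkl : k ≤ l)
    (hlm : l ≤ m) (hmj : m ≤ j) :
    (x (l - 1) : ℤ) + x l - x (k - 1) - x m ≤ ∑ s ∈ Finset.Ico i j, localRise x s := by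
  have h₁ : (x (l - 1) : ℤ) - x (k - 1) ≤ ∑ s ∈ Finset.Ico k l, localRise x s := by
    rw [← sum_Ico_sub_pred x hkl]
    exact Finset.sum_le_sum fun s _ => (le_max_left _ _).trans (le_max_right _ _)
  have h₂ : (x l : ℤ) - x m ≤ ∑ s ∈ Finset.Ico l m, localRise x s := by
    rw [← sum_Ico_sub_succ x hlm]
    exact Finset.sum_le_sum fun s _ => (le_max_right _ _).trans (le_max_right _ _)
  have h₃ := Finset.sum_Ico_consecutive (localRise x) hkl hlm
  have h₄ : ∑ s ∈ Finset.Ico k m, localRise x s ≤ ∑ s ∈ Finset.Ico i j, localRise x s :=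
    Finset.sum_le_sum_of_subset_of_nonneg (Finset.Ico_subset_Ico hik hmj)
      fun s _ _ => localRise_nonneg x s
  linarith

/-- If `x` is unimodal with peak `p`, some splitting point `l` realizes every local rise in
`[i, j)` as an up-step to the left of `l` and as a down-step from `l` on. -/
theorem exists_split_localRise {n p : ℕ} {x : ℕ → ℕ}
    (hup : ∀ s : ℕ, 1 ≤ s → s ≤ p → x (s - 1) ≤ x s)
    (hdown : ∀ t : ℕ, p ≤ t → t ≤ n - 1 → x (t + 1) ≤ x t)
    {i j : ℕ} (hi : 1 ≤ i) (hij : i ≤ j) (hj : j ≤ n) :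
    ∃ l, i ≤ l ∧ l ≤ j ∧
      (∀ s ∈ Finset.Ico i l, localRise x s = (x s : ℤ) - x (s - 1)) ∧
      ∀ s ∈ Finset.Ico l j, localRise x s = (x s : ℤ) - x (s + 1) := by
  have left : ∀ s, 1 ≤ s → s < p → localRise x s = (x s : ℤ) - x (s - 1) := by
    intro s h1 h2
    have h₁ := hup s h1 h2.le
    have h₂ := hup (s + 1) (by omega) h2
    rw [Nat.add_sub_cancel] at h₂
    unfold localRise
    omega
  have right : ∀ s, p < s → s < n → localRise x s = (x s : ℤ) - x (s + 1) := by
    intro s h1 h2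
    have h₁ := hdown s h1.le (by omega)
    have h₂ := hdown (s - 1) (by omega) (by omega)
    rw [Nat.sub_add_cancel (by omega)] at h₂
    unfold localRise
    omega
  simp only [Finset.mem_Ico]
  rcases lt_or_ge p i with hpi | hpi
  · exact ⟨i, le_rfl, hij, fun s hs => by omega,
      fun s hs => right s (by omega) (by omega)⟩
  rcases le_or_gt j p with hpj | hpj
  · exact ⟨j, hij, le_rfl, fun s hs => left s (by omega) (by omega),
      fun s hs => by omega⟩
  have peak : localRise x p = (x p : ℤ) - x (p - 1) ∨
      localRise x p = (x p : ℤ) - x (p + 1) := by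
    have h₁ := hup p (by omega) le_rfl
    have h₂ := hdown p le_rfl (by omega)
    unfold localRise
    omega
  rcases peak with h | h
  · refine ⟨p + 1, by omega, hpj, fun s hs => ?_, fun s hs => right s (by omega) (by omega)⟩
    rcases (Nat.lt_succ_iff.1 hs.2).eq_or_lt with rfl | hsp
    · exact h
    · exact left s (by omega) hsp
  · refine ⟨p, hpi, hpj.le, fun s hs => left s (by omega) hs.2, fun s hs => ?_⟩
    rcases hs.1.eq_or_lt with rfl | hsp
    · exact h
    · exact right s hsp (by omega)

theorem rnk_eq_sub_sum_localRise {n p : ℕ} {x : ℕ → ℕ}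
    (hup : ∀ s : ℕ, 1 ≤ s → s ≤ p → x (s - 1) ≤ x s)
    (hdown : ∀ t : ℕ, p ≤ t → t ≤ n - 1 → x (t + 1) ≤ x t)
    {i j : ℕ} (hi : 1 ≤ i) (hij : i ≤ j) (hj : j ≤ n) :
    rnk n x i j = (n : ℤ) + 1 - ∑ s ∈ Finset.Ico i j, localRise x s := by
  unfold rnk
  congr 1
  refine IsGreatest.csSup_eq ⟨?_, ?_⟩
  · obtain ⟨l, hil, hlj, h₁, h₂⟩ := exists_split_localRise hup hdown hi hij hj
    refine ⟨i, l, j, le_rfl, hil, hlj, le_rfl, ?_⟩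
    rw [← Finset.sum_Ico_consecutive _ hil hlj, Finset.sum_congr rfl h₁,
      Finset.sum_congr rfl h₂, sum_Ico_sub_pred x hil, sum_Ico_sub_succ x hlj]
    ring
  · rintro t ⟨k, l, m, hik, hkl, hlm, hmj, rfl⟩
    exact le_sum_localRise x hik hkl hlm hmj

/-- for a single-peak Motzkin path `x` of length `n`, the rank tuple
`r(x)` satisfies the defining conditions of the PBW locus: (a) `r(x)_{k,k+1} ∈ {n, n+1}`
for `1 ≤ k ≤ n-1`; (b) for `1 ≤ i ≤ j ≤ n` with `j - i ≥ 2`,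
`r(x)_{ij} = n + 1 - #{k : i ≤ k ≤ j-1, r(x)_{k,k+1} = n}`. -/
theorem stmt10 (n : ℕ) (hn : 1 ≤ n) (x : ℕ → ℕ)
    (hx0 : x 0 = 0) (hxn : x n = 0)
    (hmotzkin : ∀ i : ℕ, 1 ≤ i → i ≤ n → |(x i : ℤ) - x (i - 1)| ≤ 1)
    (p : ℕ) (hp1 : 1 ≤ p) (hp2 : p ≤ n - 1)
    (hpeak1 : ∀ s : ℕ, 1 ≤ s → s ≤ p → x (s - 1) ≤ x s)
    (hpeak2 : ∀ t : ℕ, p ≤ t → t ≤ n - 1 → x (t + 1) ≤ x t) :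
    (∀ k : ℕ, 1 ≤ k → k ≤ n - 1 → rnk n x k (k + 1) = n ∨ rnk n x k (k + 1) = n + 1) ∧
    (∀ i j : ℕ, 1 ≤ i → i + 2 ≤ j → j ≤ n →
      rnk n x i j = (n : ℤ) + 1 -
        ({k : ℕ | i ≤ k ∧ k ≤ j - 1 ∧ rnk n x k (k + 1) = n}.ncard : ℤ)) := by
  have local_eq : ∀ k, 1 ≤ k → k ≤ n - 1 → rnk n x k (k + 1) = n + 1 - localRise x k := by
    intro k h1 h2
    rw [rnk_eq_sub_sum_localRise hpeak1 hpeak2 h1 k.le_succ (by omega), Nat.Ico_succ_singleton,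
      Finset.sum_singleton]
  have zero_or_one : ∀ k, 1 ≤ k → k ≤ n - 1 → localRise x k = 0 ∨ localRise x k = 1 := by
    intro k h1 h2
    have h₁ := abs_le.1 (hmotzkin k h1 (by omega))
    have h₂ := abs_le.1 (hmotzkin (k + 1) (by omega) (by omega))
    rw [Nat.add_sub_cancel] at h₂
    unfold localRise
    omega
  refine ⟨fun k h1 h2 => ?_, fun i j hi hij hj => ?_⟩
  · have h₁ := local_eq k h1 h2
    have h₂ := zero_or_one k h1 h2
    omega
  · have hset : {k : ℕ | i ≤ k ∧ k ≤ j - 1 ∧ rnk n x k (k + 1) = n} =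
        ((Finset.Ico i j).filter fun k => localRise x k = 1 : Finset ℕ) := by
      ext k
      simp only [Set.mem_ofPred_eq, Finset.coe_filter, Finset.mem_Ico]
      constructor
      · rintro ⟨h1, h2, h3⟩
        rw [local_eq k (by omega) (by omega)] at h3
        omega
      · rintro ⟨h1, h2⟩
        refine ⟨h1.1, by omega, ?_⟩
        rw [local_eq k (by omega) (by omega)]
        omega
    rw [rnk_eq_sub_sum_localRise hpeak1 hpeak2 hi (by omega) hj, hset, Set.ncard_coe_finset,
      Finset.card_filter, Nat.cast_sum]
    congr 1
    refine Finset.sum_congr rfl fun k hk => ?_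
    rw [Finset.mem_Ico] at hk
    rcases zero_or_one k (by omega) (by omega) with h | h <;> simp [h]
end

section
/- Let n ≥ 1 and let x = (x_0, …, x_n) be a Motzkin path of length n. Let 1 ≤ p ≤ n − 1 be such that: x_{s−1} ≤ x_s for all 1 ≤ s ≤ p; x_t ≥ x_{t+1} for all p ≤ t ≤ n − 1; and x_t < x_p for all t with p < t ≤ n − 1. Then for all 1 ≤ i ≤ p ≤ j ≤ n, max{ x_{l−1} + x_l − x_{k−1} − x_m : i ≤ k ≤ l ≤ m ≤ j } = (x_{p−1} − x_{i−1}) + (x_p − x_j). -/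
/-- for a Motzkin path `x` of length `n` with maximal peak `p`, and
`1 ≤ i ≤ p ≤ j ≤ n`, the maximum of `x_{l-1} + x_l - x_{k-1} - x_m` over
`i ≤ k ≤ l ≤ m ≤ j` equals `(x_{p-1} - x_{i-1}) + (x_p - x_j)`. -/
theorem stmt12 (n : ℕ) (hn : 1 ≤ n) (x : ℕ → ℕ)
    (hx0 : x 0 = 0) (hxn : x n = 0)
    (hmotzkin : ∀ i : ℕ, 1 ≤ i → i ≤ n → |(x i : ℤ) - x (i - 1)| ≤ 1)
    (p : ℕ) (hp1 : 1 ≤ p) (hp2 : p ≤ n - 1)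
    (hpeak1 : ∀ s : ℕ, 1 ≤ s → s ≤ p → x (s - 1) ≤ x s)
    (hpeak2 : ∀ t : ℕ, p ≤ t → t ≤ n - 1 → x (t + 1) ≤ x t)
    (hpmax : ∀ t : ℕ, p < t → t ≤ n - 1 → x t < x p)
    (i j : ℕ) (hi : 1 ≤ i) (hip : i ≤ p) (hpj : p ≤ j) (hj : j ≤ n) :
    sSup {t : ℤ | ∃ k l m : ℕ, i ≤ k ∧ k ≤ l ∧ l ≤ m ∧ m ≤ j ∧
        t = (x (l - 1) : ℤ) + x l - x (k - 1) - x m} =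
    ((x (p - 1) : ℤ) - x (i - 1)) + ((x p : ℤ) - x j) := by
  have hmono : ∀ a b : ℕ, a ≤ b → b ≤ p → x a ≤ x b := by
    intro a b hab
    induction b, hab using Nat.le_induction with
    | base => exact fun _ => le_rfl
    | succ b hab ih =>
      intro hb
      exact (ih (by omega)).trans (by simpa using hpeak1 (b + 1) (by omega) hb)
  have hanti : ∀ a b : ℕ, p ≤ a → a ≤ b → b ≤ n → x b ≤ x a := by
    intro a b ha hab
    induction b, hab using Nat.le_induction with
    | base => exact fun _ => le_rfl
    | succ b hab ih =>
      intro hb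
      exact (hpeak2 b (by omega) (by omega)).trans (ih (by omega))
  have hstep : ∀ l : ℕ, p < l → l ≤ n → x l ≤ x (p - 1) := by
    intro l hl hln
    rcases hln.eq_or_lt with rfl | hlt
    · omega
    · have h1 := hpmax l hl (by omega)
      have h2 := (abs_le.mp (hmotzkin p hp1 (by omega))).2
      omega
  refine IsGreatest.csSup_eq ⟨⟨i, p, j, le_rfl, hip, hpj, le_rfl, by ring⟩, ?_⟩
  rintro t ⟨k, l, m, hik, hkl, hlm, hmj, rfl⟩
  have hpj' := hanti p j le_rfl hpj hj
  rcases le_or_gt l p with hl | hl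
  · have h1 := hmono (l - 1) (p - 1) (by omega) (by omega)
    have h2 := hmono (i - 1) (k - 1) (by omega) (by omega)
    have h3 := hmono l p hl le_rfl
    rcases le_or_gt p m with hm | hm
    · have h4 := hanti m j hm hmj hj
      omega
    · have h4 := hmono l m hlm hm.le
      omega
  · have h1 := hstep l hl (by omega)
    have h2 := hanti m j (by omega) hmj hj
    rcases le_or_gt k p with hk | hk
    · have h3 := hmono (i - 1) (k - 1) (by omega) (by omega)
      have h4 := hanti p (l - 1) le_rfl (by omega) (by omega)
      omega
    · have h3 := hanti (k - 1) (l - 1) (by omega) (by omega) (by omega)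
      have h4 := hanti p l le_rfl hl.le (by omega)
      have h5 := hmono (i - 1) (p - 1) (by omega) (by omega)
      omega
end

section
/- Fix n ≥ 1 and nonnegative integers e_1, …, e_n, f_1, …, f_n. In the algebra U, the following identity holds: E_1^{(f_1)} E_2^{(f_2)} ⋯ E_n^{(f_n)} · E_1^{(e_1)} E_2^{(e_2)} ⋯ E_n^{(e_n)} = Σ_x v^{ − Σ_{i=1}^{n−1} (e_i − x_i)(f_{i+1} − x_i) } · ( Π_{i=1}^{n} binom( e_i + f_i − x_{i−1} − x_i , f_i − x_{i−1} )_v ) · E(x), where the sum ranges over all tuples x = (x_1, …, x_{n−1}) of nonnegative integers with 0 ≤ x_i ≤ min(e_i, f_{i+1}) for all i (convention x_0 = x_n = 0), and E(x) = E_1^{(e_1+f_1−x_1)} E_{1,2}^{(x_1)} E_2^{(e_2+f_2−x_1−x_2)} E_{2,3}^{(x_2)} ⋯ E_{n−1}^{(e_{n−1}+f_{n−1}−x_{n−2}−x_{n−1})} E_{n−1,n}^{(x_{n−1})} E_n^{(e_n+f_n−x_{n−1})}. -/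
noncomputable section

/-- The base field `K = ℚ(v)`. -/
abbrev K : Type := RatFunc ℚ

/-- The variable `v ∈ ℚ(v)`. -/
noncomputable def v : K := RatFunc.X

/-- The quantum integer `[k]_v = (v^k - v^{-k})/(v - v^{-1})`. -/
noncomputable def qint (k : ℕ) : K := (v ^ k - v⁻¹ ^ k) / (v - v⁻¹)

/-- The quantum factorial `[k]_v!`. -/
noncomputable def qfact : ℕ → K
  | 0 => 1
  | k + 1 => qint (k + 1) * qfact k

/-- The quantum binomial coefficient `binom(k, m)_v`. -/
noncomputable def qbinom (k m : ℕ) : K := qfact k / (qfact m * qfact (k - m))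

/-- The defining relations of `U_v^+(sl_{n+1})`: commutation for distant indices
and the quantum Serre relations for adjacent indices. -/
inductive SerreRel (n : ℕ) : FreeAlgebra K (Fin n) → FreeAlgebra K (Fin n) → Prop
  | comm (i j : Fin n) (h : (i : ℕ) + 1 < (j : ℕ)) :
      SerreRel n (FreeAlgebra.ι K i * FreeAlgebra.ι K j) (FreeAlgebra.ι K j * FreeAlgebra.ι K i)
  | serre (i j : Fin n) (h : (i : ℕ) + 1 = (j : ℕ) ∨ (j : ℕ) + 1 = (i : ℕ)) :
      SerreRel n (FreeAlgebra.ι K i ^ 2 * FreeAlgebra.ι K j + FreeAlgebra.ι K j * FreeAlgebra.ι K i ^ 2)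
        ((v + v⁻¹) • (FreeAlgebra.ι K i * FreeAlgebra.ι K j * FreeAlgebra.ι K i))

/-- The algebra `U = U_v^+(sl_{n+1})`, presented by generators `E_1, …, E_n` and the
quantum Serre relations. -/
abbrev Uq (n : ℕ) := RingQuot (SerreRel n)

/-- The Chevalley generator `E_i ∈ U` for `1 ≤ i ≤ n` (junk value `0` outside this range). -/
noncomputable def E (n : ℕ) (i : ℕ) : Uq n :=
  if h : i - 1 < n ∧ 1 ≤ i then
    RingQuot.mkAlgHom K (SerreRel n) (FreeAlgebra.ι K (⟨i - 1, h.1⟩ : Fin n)) else 0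

/-- The divided power `u^{(r)} = u^r / [r]_v!`. -/
noncomputable def dp (n : ℕ) (u : Uq n) (r : ℕ) : Uq n := (qfact r)⁻¹ • u ^ r

/-- The root vector `E_{i,i+1} = E_{i+1}E_i - v^{-1}E_iE_{i+1}`. -/
noncomputable def Ebr (n : ℕ) (i : ℕ) : Uq n :=
  E n (i + 1) * E n i - v⁻¹ • (E n i * E n (i + 1))

/-- The ordered product `g 1 * g 2 * ⋯ * g n` in `U`. -/
noncomputable def Eprod (n : ℕ) (g : ℕ → Uq n) : Uq n :=
  ((List.range n).map fun k => g (k + 1)).prod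

/-- Extension of a tuple `(x_1, …, x_{n-1})` (given as a function on `Fin (n-1)`)
to a function on `ℕ`, with the convention `x_k = 0` for `k = 0` and `k ≥ n`. -/
def tup (n : ℕ) (x : Fin (n - 1) → ℕ) (k : ℕ) : ℕ :=
  if h : k - 1 < n - 1 ∧ 1 ≤ k then x ⟨k - 1, h.1⟩ else 0


lemma v_ne_zero : v ≠ 0 := RatFunc.X_ne_zero

lemma v_pow_ne_one {k : ℕ} (hk : k ≠ 0) : v ^ k ≠ 1 := by
  intro h
  have h' : (Polynomial.X : Polynomial ℚ) ^ k = 1 := by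
    apply RatFunc.algebraMap_injective ℚ
    simpa [v, RatFunc.algebraMap_X] using h
  have := congrArg Polynomial.natDegree h'
  simp at this
  exact hk this

lemma v_pow_sub_ne_zero {k : ℕ} (hk : k ≠ 0) : v ^ k - v⁻¹ ^ k ≠ 0 := by
  intro h
  apply v_pow_ne_one (k := k + k) (by omega)
  rw [pow_add]
  nth_rewrite 1 [sub_eq_zero.1 h]
  rw [← mul_pow, inv_mul_cancel₀ v_ne_zero, one_pow]

lemma v_sub_ne_zero : v - v⁻¹ ≠ 0 := by
  simpa using v_pow_sub_ne_zero one_ne_zero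

lemma qint_ne_zero {k : ℕ} (hk : k ≠ 0) : qint k ≠ 0 :=
  div_ne_zero (v_pow_sub_ne_zero hk) v_sub_ne_zero

lemma qint_zero : qint 0 = 0 := by simp [qint]

lemma qint_one : qint 1 = 1 := by simp [qint, div_self v_sub_ne_zero]

lemma qfact_ne_zero (k : ℕ) : qfact k ≠ 0 := by
  induction k with
  | zero => simp [qfact]
  | succ k ih => exact mul_ne_zero (qint_ne_zero k.succ_ne_zero) ih

lemma qint_add (x j : ℕ) : qint (x + j) = v ^ x * qint j + v⁻¹ ^ j * qint x := by
  unfold qint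
  rw [← mul_div_assoc, ← mul_div_assoc, ← add_div]
  congr 1
  ring

section DividedPowers

variable {n : ℕ}

lemma dp_zero (u : Uq n) : dp n u 0 = 1 := by simp [dp, qfact]

lemma dp_succ (u : Uq n) (k : ℕ) : qint (k + 1) • dp n u (k + 1) = u * dp n u k := by
  simp only [dp, qfact, mul_smul_comm, smul_smul, mul_inv, ← pow_succ']
  rw [mul_inv_cancel_left₀ (qint_ne_zero k.succ_ne_zero)]

lemma dp_mul_dp (u : Uq n) (k l : ℕ) :
    dp n u k * dp n u l = qbinom (l + k) k • dp n u (l + k) := by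
  have := qfact_ne_zero (l + k)
  simp only [dp, qbinom, smul_mul_smul_comm, smul_smul, ← pow_add, Nat.add_sub_cancel,
    add_comm k l]
  congr 1
  field_simp

lemma dp_commute {a b : Uq n} (h : Commute a b) (k l : ℕ) : Commute (dp n a k) (dp n b l) :=
  ((h.pow_pow k l).smul_left _).smul_right _

lemma mul_pow_of_mul_eq_smul {b c : Uq n} (h : b * c = v • (c * b)) (x : ℕ) :
    b * c ^ x = v ^ x • (c ^ x * b) := by
  induction x with
  | zero => simp
  | succ x ih =>
    rw [pow_succ, ← mul_assoc, ih, smul_mul_assoc, mul_assoc, h, mul_smul_comm, smul_smul,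
      pow_succ, mul_assoc]

lemma mul_dp_of_mul_eq_smul {b c : Uq n} (h : b * c = v • (c * b)) (x : ℕ) :
    b * dp n c x = v ^ x • (dp n c x * b) := by
  rw [dp, mul_smul_comm, mul_pow_of_mul_eq_smul h, smul_mul_assoc, smul_comm]

lemma mul_pow_succ_of_bracket {a b c : Uq n} (hba : b * a = c + v⁻¹ • (a * b))
    (hca : c * a = v • (a * c)) (k : ℕ) :
    b * a ^ (k + 1) = v⁻¹ ^ (k + 1) • (a ^ (k + 1) * b) + qint (k + 1) • (a ^ k * c) := by
  induction k with
  | zero =>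
    simp [hba, qint_one, add_comm]
  | succ k ih =>
    have hq : qint (k + 1 + 1) = v⁻¹ ^ (k + 1) + v * qint (k + 1) := by
      rw [add_comm (k + 1) 1, qint_add, qint_one]
      ring
    rw [pow_succ a (k + 1), ← mul_assoc, ih, add_mul, smul_mul_assoc, smul_mul_assoc, mul_assoc,
      hba, mul_assoc, hca, hq, mul_add, mul_smul_comm, mul_smul_comm, ← mul_assoc, ← mul_assoc,
      ← pow_succ, ← pow_succ, smul_add, smul_smul, smul_smul, add_smul,
      pow_succ v⁻¹ (k + 1), mul_comm v]
    abel

lemma mul_dp_succ_of_bracket {a b c : Uq n} (hba : b * a = c + v⁻¹ • (a * b))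
    (hca : c * a = v • (a * c)) (k : ℕ) :
    b * dp n a (k + 1) = v⁻¹ ^ (k + 1) • (dp n a (k + 1) * b) + dp n a k * c := by
  simp only [dp, mul_smul_comm, mul_pow_succ_of_bracket hba hca, smul_mul_assoc, smul_add]
  rw [smul_comm]
  congr 1
  rw [smul_smul]
  congr 1
  have := qfact_ne_zero k
  have := qint_ne_zero k.succ_ne_zero
  simp only [qfact]
  field_simp

/-- Left multiplication by `b` on an ordered monomial `a^{(i)} c^{(x)} b^{(j)}`. -/
lemma mul_dp_mul_dp_mul_dp {a b c : Uq n} (hba : b * a = c + v⁻¹ • (a * b))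
    (hca : c * a = v • (a * c)) (hbc : b * c = v • (c * b)) (i x j : ℕ) :
    b * (dp n a i * dp n c x * dp n b j) =
      (v⁻¹ ^ i * v ^ x * qint (j + 1)) • (dp n a i * dp n c x * dp n b (j + 1)) +
      if i = 0 then 0 else
        qint (x + 1) • (dp n a (i - 1) * dp n c (x + 1) * dp n b j) := by
  have key : ∀ i, dp n a i * b * dp n c x * dp n b j =
      (v ^ x * qint (j + 1)) • (dp n a i * dp n c x * dp n b (j + 1)) := by
    intro i
    rw [mul_assoc (dp n a i), mul_dp_of_mul_eq_smul hbc, mul_smul_comm, smul_mul_assoc, mul_smul,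
      ← mul_smul_comm (qint (j + 1)), dp_succ]
    simp only [mul_assoc]
  cases i with
  | zero =>
    have := key 0
    simp only [dp_zero, one_mul] at this ⊢
    simp [← mul_assoc, this]
  | succ i =>
    rw [← mul_assoc, ← mul_assoc, mul_dp_succ_of_bracket hba hca, add_mul, add_mul, smul_mul_assoc,
      smul_mul_assoc, key, smul_smul, mul_assoc (v⁻¹ ^ (i + 1)), if_neg i.succ_ne_zero,
      mul_assoc (dp n a i) c, ← dp_succ]
    simp

/-- Reordering `b^{(m)} a^{(k)}` when `c = ba - v⁻¹ab` `v`-commutes with `a` and `b`; terms with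
`x > m` are set to zero. -/
lemma dp_mul_dp_eq_sum_ite {a b c : Uq n} (hba : b * a = c + v⁻¹ • (a * b))
    (hca : c * a = v • (a * c)) (hbc : b * c = v • (c * b)) (k m : ℕ) :
    dp n b m * dp n a k = ∑ x ∈ Finset.range (k + 1), if x ≤ m then
      v⁻¹ ^ ((k - x) * (m - x)) • (dp n a (k - x) * dp n c x * dp n b (m - x)) else 0 := by
  induction m with
  | zero =>
    rw [Finset.sum_range_succ']
    simp [dp_zero]
  | succ m ih =>
    apply smul_right_injective (Uq n) (qint_ne_zero m.succ_ne_zero)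
    dsimp only
    rw [← smul_mul_assoc, dp_succ, mul_assoc, ih, Finset.mul_sum, Finset.smul_sum]
    set P : ℕ → Uq n := fun x => if x ≤ m then
      (v⁻¹ ^ ((k - x) * (m + 1 - x)) * (v ^ x * qint (m + 1 - x))) •
        (dp n a (k - x) * dp n c x * dp n b (m + 1 - x)) else 0 with hP
    set Q : ℕ → Uq n := fun x => if x ≤ m + 1 then
      (v⁻¹ ^ ((k - x) * (m + 1 - x)) * (v⁻¹ ^ (m + 1 - x) * qint x)) •
        (dp n a (k - x) * dp n c x * dp n b (m + 1 - x)) else 0 with hQ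
    have h1 : ∀ x ∈ Finset.range (k + 1), (b * if x ≤ m then
        v⁻¹ ^ ((k - x) * (m - x)) • (dp n a (k - x) * dp n c x * dp n b (m - x)) else 0) =
        P x + if x = k then 0 else Q (x + 1) := by
      intro x hx
      obtain ⟨i, rfl⟩ : ∃ i, k = x + i := Nat.exists_eq_add_of_le (by simp at hx; omega)
      by_cases hxm : x ≤ m
      · obtain ⟨j, rfl⟩ := Nat.exists_eq_add_of_le hxm
        have e1 : x + i - (x + 1) = i - 1 := by omega
        have e2 : x + j + 1 - x = j + 1 := by omega
        have e3 : x + j + 1 - (x + 1) = j := by omega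
        simp only [hP, hQ, hxm, if_true, Nat.add_sub_cancel_left, mul_smul_comm,
          mul_dp_mul_dp_mul_dp hba hca hbc, e1, e2, e3, smul_add, add_le_add_iff_right]
        congr 1
        · rw [smul_smul]
          congr 1
          ring
        · cases i with
          | zero => simp
          | succ i =>
            simp only [Nat.add_eq_zero_iff, one_ne_zero, and_false, if_false, smul_smul,
              Nat.add_sub_cancel, left_eq_add]
            congr 1
            ring
      · have : ¬ x + 1 ≤ m + 1 := by omega
        simp [hP, hQ, hxm]
    have h2 : ∀ x ∈ Finset.range (k + 1), (qint (m + 1) • if x ≤ m + 1 then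
        v⁻¹ ^ ((k - x) * (m + 1 - x)) • (dp n a (k - x) * dp n c x * dp n b (m + 1 - x)) else 0) =
        P x + Q x := by
      intro x _
      rcases lt_trichotomy x (m + 1) with hx | hx | hx
      · have hxm : x ≤ m := by omega
        simp only [hP, hQ, hxm, hx.le, if_true, ← add_smul, smul_smul, ← mul_add, ← qint_add]
        rw [Nat.add_sub_cancel' hx.le, mul_comm]
      · subst hx
        simp [hP, hQ]
      · have h3 : ¬ x ≤ m := by omega
        have h4 : ¬ x ≤ m + 1 := by omega
        simp [hP, hQ, h3, h4]
    rw [Finset.sum_congr rfl h1, Finset.sum_congr rfl h2, Finset.sum_add_distrib,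
      Finset.sum_add_distrib, Finset.sum_range_succ' Q k,
      Finset.sum_range_succ (fun x => if x = k then 0 else Q (x + 1)) k]
    have hQ0 : Q 0 = 0 := by simp [hQ, qint_zero]
    rw [hQ0, if_pos rfl]
    congr 2
    exact Finset.sum_congr rfl fun x hx => if_neg (Finset.mem_range.1 hx).ne

lemma dp_mul_dp_eq_sum {a b c : Uq n} (hba : b * a = c + v⁻¹ • (a * b))
    (hca : c * a = v • (a * c)) (hbc : b * c = v • (c * b)) (k m : ℕ) :
    dp n b m * dp n a k = ∑ x ∈ Finset.range (min k m + 1),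
      v⁻¹ ^ ((k - x) * (m - x)) • (dp n a (k - x) * dp n c x * dp n b (m - x)) := by
  rw [dp_mul_dp_eq_sum_ite hba hca hbc, ← Finset.sum_filter]
  congr 1
  ext x
  simp only [Finset.mem_filter, Finset.mem_range]
  omega

end DividedPowers

section Relations

variable {n : ℕ}

lemma E_commute {i j : ℕ} (hi : 1 ≤ i) (hij : i + 1 < j) (hj : j ≤ n) :
    Commute (E n i) (E n j) := by
  have h1 : i - 1 < n ∧ 1 ≤ i := by omega
  have h2 : j - 1 < n ∧ 1 ≤ j := by omega
  have := RingQuot.mkAlgHom_rel K (SerreRel.comm (n := n) ⟨i - 1, h1.1⟩ ⟨j - 1, h2.1⟩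
    (by simp; omega))
  simp only [E, dif_pos h1, dif_pos h2]
  simpa [Commute, SemiconjBy] using this

lemma E_serre {i j : ℕ} (hi : 1 ≤ i) (hj : 1 ≤ j) (hin : i ≤ n) (hjn : j ≤ n)
    (hij : i + 1 = j ∨ j + 1 = i) :
    E n i ^ 2 * E n j + E n j * E n i ^ 2 = (v + v⁻¹) • (E n i * E n j * E n i) := by
  have h1 : i - 1 < n ∧ 1 ≤ i := by omega
  have h2 : j - 1 < n ∧ 1 ≤ j := by omega
  have := RingQuot.mkAlgHom_rel K (SerreRel.serre (n := n) ⟨i - 1, h1.1⟩ ⟨j - 1, h2.1⟩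
    (by simp; omega))
  simp only [E, dif_pos h1, dif_pos h2]
  simpa only [map_add, map_mul, map_pow, map_smul] using this

lemma E_succ_mul_E (i : ℕ) : E n (i + 1) * E n i = Ebr n i + v⁻¹ • (E n i * E n (i + 1)) := by
  simp [Ebr]

lemma Ebr_mul_E {i : ℕ} (hi : 1 ≤ i) (hin : i + 1 ≤ n) :
    Ebr n i * E n i = v • (E n i * Ebr n i) := by
  have h := E_serre (n := n) (i := i) (j := i + 1) hi (by omega) (by omega) hin (Or.inl rfl)
  simp only [Ebr, sub_mul, mul_sub, smul_sub, mul_smul_comm, smul_mul_assoc, smul_smul,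
    mul_inv_cancel₀ v_ne_zero, one_smul]
  rw [add_smul, pow_two] at h
  simp only [mul_assoc] at h ⊢
  rw [← sub_eq_zero] at h ⊢
  rw [← h]
  abel

lemma E_succ_mul_Ebr {i : ℕ} (hi : 1 ≤ i) (hin : i + 1 ≤ n) :
    E n (i + 1) * Ebr n i = v • (Ebr n i * E n (i + 1)) := by
  have h := E_serre (n := n) (i := i + 1) (j := i) (by omega) hi hin (by omega) (Or.inr rfl)
  simp only [Ebr, sub_mul, mul_sub, smul_sub, mul_smul_comm, smul_mul_assoc, smul_smul,
    mul_inv_cancel₀ v_ne_zero, one_smul]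
  rw [add_smul, pow_two] at h
  simp only [mul_assoc] at h ⊢
  rw [← sub_eq_zero] at h ⊢
  rw [← h]
  abel

end Relations

section OrderedProducts

variable {A : Type*} [Semiring A]

/-- If `F (i + 1)` commutes with `G j` for `j < i`, the product `F_0 ⋯ F_p · G_0 ⋯ G_{p-1}`
regroups into adjacent pairs. -/
lemma prod_range_mul_prod_range_of_commute (F G : ℕ → A) (p : ℕ)
    (h : ∀ i ≤ p, ∀ j, j + 1 < i → Commute (F i) (G j)) :
    ((List.range (p + 1)).map F).prod * ((List.range p).map G).prod =
      F 0 * ((List.range p).map fun i => F (i + 1) * G i).prod := by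
  induction p with
  | zero => simp
  | succ p ih =>
    have hc : Commute (F (p + 1)) ((List.range p).map G).prod := by
      refine Commute.list_prod_right _ _ fun g hg => ?_
      obtain ⟨j, hj, rfl⟩ := List.mem_map.1 hg
      exact h _ le_rfl _ (by simpa using hj)
    rw [List.prod_range_succ F, List.prod_range_succ G,
      List.prod_range_succ (fun i => F (i + 1) * G i), ← mul_assoc (F 0),
      ← ih fun i hi j hj => h i (by omega) j hj]
    simp only [mul_assoc]
    rw [← mul_assoc (F (p + 1)), hc.eq]
    simp only [mul_assoc]

/-- Distributivity of an ordered product of finite sums in a noncommutative semiring. -/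
lemma prod_map_range_sum (s : ℕ → Finset ℕ) (t : ℕ → ℕ → A) (p : ℕ) :
    ((List.range p).map fun i => ∑ x ∈ s i, t i x).prod =
      ∑ x ∈ Fintype.piFinset fun i : Fin p => s i, (List.ofFn fun i : Fin p => t i (x i)).prod := by
  induction p with
  | zero => simp
  | succ p ih =>
    rw [List.range_succ, List.map_append, List.prod_append, ih, List.map_singleton,
      List.prod_singleton, Finset.sum_mul_sum, ← Finset.sum_product']
    refine Finset.sum_bij' (fun y _ => Fin.snoc (α := fun _ => ℕ) y.1 y.2)
      (fun x _ => (Fin.init x, x (Fin.last p))) ?_ ?_ ?_ ?_ ?_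
    · rintro ⟨y, z⟩ h
      simp only [Finset.mem_product, Fintype.mem_piFinset] at h ⊢
      intro i
      refine Fin.lastCases ?_ (fun i => ?_) i
      · simpa using h.2
      · simpa using h.1 i
    · intro x h
      simp only [Finset.mem_product, Fintype.mem_piFinset] at h ⊢
      exact ⟨fun i => h i.castSucc, h (Fin.last p)⟩
    · rintro ⟨y, z⟩ h
      simp
    · intro x h
      simp
    · rintro ⟨y, z⟩ h
      rw [List.ofFn_succ']
      simp [List.concat_eq_append]

end OrderedProducts

section Expansion

@[to_additive]
lemma prod_Icc_eq_prod_range {M : Type*} [CommMonoid M] (g : ℕ → M) (p : ℕ) :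
    ∏ i ∈ Finset.Icc 1 p, g i = ∏ i ∈ Finset.range p, g (i + 1) := by
  rw [← Finset.Ico_add_one_right_eq_Icc, Finset.prod_Ico_eq_prod_range, Nat.add_sub_cancel]
  simp only [add_comm 1]

variable {n : ℕ}

lemma tup_zero (x : Fin (n - 1) → ℕ) : tup n x 0 = 0 := by simp [tup]

lemma tup_self (x : Fin (n - 1) → ℕ) : tup n x n = 0 := by simp [tup]

lemma tup_succ (x : Fin (n - 1) → ℕ) (i : Fin (n - 1)) : tup n x (i + 1) = x i := by simp [tup]

/-- Merging the divided powers of each `E_k` in one monomial of the expansion. -/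
lemma dp_mul_prod_eq_smul_prod (e f y : ℕ → ℕ) (p : ℕ) (hy0 : y 0 = 0)
    (hy : ∀ i < p, y (i + 1) ≤ e (i + 1) ∧ y (i + 1) ≤ f (i + 2)) :
    dp n (E n 1) (f 1) * ((List.range p).map fun i =>
        v⁻¹ ^ ((e (i + 1) - y (i + 1)) * (f (i + 2) - y (i + 1))) •
          (dp n (E n (i + 1)) (e (i + 1) - y (i + 1)) * dp n (Ebr n (i + 1)) (y (i + 1)) *
            dp n (E n (i + 2)) (f (i + 2) - y (i + 1)))).prod =
      (v⁻¹ ^ (∑ i ∈ Finset.range p, (e (i + 1) - y (i + 1)) * (f (i + 2) - y (i + 1))) *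
        ∏ i ∈ Finset.range p,
          qbinom (e (i + 1) + f (i + 1) - y i - y (i + 1)) (f (i + 1) - y i)) •
      (((List.range p).map fun i =>
        dp n (E n (i + 1)) (e (i + 1) + f (i + 1) - y i - y (i + 1)) *
          dp n (Ebr n (i + 1)) (y (i + 1))).prod * dp n (E n (p + 1)) (f (p + 1) - y p)) := by
  induction p with
  | zero => simp [hy0]
  | succ p ih =>
    have hp : y p ≤ f (p + 1) := by
      cases p with
      | zero => simp [hy0]
      | succ p => exact (hy p (by omega)).2
    have hp' := (hy p (by omega)).1
    have hm := dp_mul_dp (E n (p + 1)) (f (p + 1) - y p) (e (p + 1) - y (p + 1))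
    rw [show e (p + 1) - y (p + 1) + (f (p + 1) - y p) =
      e (p + 1) + f (p + 1) - y p - y (p + 1) by omega] at hm
    rw [List.range_succ, List.map_append, List.map_append, List.prod_append, List.prod_append,
      ← mul_assoc, ih fun i hi => hy i (by omega), List.map_singleton, List.map_singleton,
      List.prod_singleton, List.prod_singleton, Finset.sum_range_succ, Finset.prod_range_succ,
      smul_mul_smul_comm]
    simp only [mul_assoc]
    rw [← mul_assoc (dp n (E n (p + 1)) _) (dp n (E n (p + 1)) _), hm]
    simp only [smul_mul_assoc, mul_smul_comm, smul_smul, mul_assoc]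
    congr 1
    ring

end Expansion

/-- the PBW-type expansion (Lemma 5.1 of the paper) of the product
`E_1^{(f_1)} ⋯ E_n^{(f_n)} · E_1^{(e_1)} ⋯ E_n^{(e_n)}` in `U`. -/
theorem stmt15 (n : ℕ) (hn : 1 ≤ n) (e f : ℕ → ℕ) :
    Eprod n (fun i => dp n (E n i) (f i)) * Eprod n (fun i => dp n (E n i) (e i)) =
    ∑ x ∈ Fintype.piFinset
        (fun i : Fin (n - 1) => Finset.range (min (e ((i : ℕ) + 1)) (f ((i : ℕ) + 2)) + 1)),
      (v ^ (-((∑ i ∈ Finset.Icc 1 (n - 1),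
            (e i - tup n x i) * (f (i + 1) - tup n x i) : ℕ) : ℤ)) *
        ∏ i ∈ Finset.Icc 1 n,
          qbinom (e i + f i - tup n x (i - 1) - tup n x i) (f i - tup n x (i - 1))) •
      Eprod n (fun k =>
        dp n (E n k) (e k + f k - tup n x (k - 1) - tup n x k) * dp n (Ebr n k) (tup n x k)) := by
  obtain ⟨m, rfl⟩ := Nat.exists_eq_add_of_le' hn
  have hcomm : ∀ i ≤ m, ∀ j, j + 1 < i → Commute (dp (m + 1) (E (m + 1) (i + 1)) (f (i + 1)))
      (dp (m + 1) (E (m + 1) (j + 1)) (e (j + 1))) := fun i hi j hj =>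
    dp_commute (E_commute (by omega) (by omega) (by omega)).symm _ _
  have hpair : ∀ i ∈ List.range m,
      dp (m + 1) (E (m + 1) (i + 1 + 1)) (f (i + 1 + 1)) *
        dp (m + 1) (E (m + 1) (i + 1)) (e (i + 1)) = _ := fun i hi =>
    have hi : i < m := List.mem_range.1 hi
    dp_mul_dp_eq_sum (E_succ_mul_E (i + 1)) (Ebr_mul_E (by omega) (by omega))
      (E_succ_mul_Ebr (by omega) (by omega)) (e (i + 1)) (f (i + 2))
  simp only [Eprod]
  rw [List.prod_range_succ (fun k => dp (m + 1) (E (m + 1) (k + 1)) (e (k + 1))), ← mul_assoc,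
    prod_range_mul_prod_range_of_commute _ _ m hcomm, List.map_congr_left hpair,
    prod_map_range_sum, Finset.mul_sum, Finset.sum_mul]
  refine Finset.sum_congr rfl fun x hx => ?_
  have hx' : ∀ i < m, tup (m + 1) x (i + 1) ≤ e (i + 1) ∧ tup (m + 1) x (i + 1) ≤ f (i + 2) := by
    intro i hi
    have h1 := Fintype.mem_piFinset.1 hx ⟨i, hi⟩
    have h2 := tup_succ (n := m + 1) x ⟨i, hi⟩
    simp only [Finset.mem_range] at h1 h2
    omega
  have hlist : (List.ofFn fun i : Fin m => v⁻¹ ^ ((e (i + 1) - x i) * (f (i + 2) - x i)) •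
      (dp (m + 1) (E (m + 1) (i + 1)) (e (i + 1) - x i) * dp (m + 1) (Ebr (m + 1) (i + 1)) (x i) *
        dp (m + 1) (E (m + 1) (i + 1 + 1)) (f (i + 2) - x i))) =
      (List.range m).map fun i =>
        v⁻¹ ^ ((e (i + 1) - tup (m + 1) x (i + 1)) * (f (i + 2) - tup (m + 1) x (i + 1))) •
          (dp (m + 1) (E (m + 1) (i + 1)) (e (i + 1) - tup (m + 1) x (i + 1)) *
            dp (m + 1) (Ebr (m + 1) (i + 1)) (tup (m + 1) x (i + 1)) *
            dp (m + 1) (E (m + 1) (i + 2)) (f (i + 2) - tup (m + 1) x (i + 1))) := by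
    refine List.ext_getElem (by simp) fun i h1 h2 => ?_
    have hi : i < m := by simpa using h1
    have := tup_succ (n := m + 1) x ⟨i, hi⟩
    simp only [List.getElem_ofFn, List.getElem_map, List.getElem_range, this]
  have hf : tup (m + 1) x m ≤ f (m + 1) := by
    cases m with
    | zero => simp [tup_zero]
    | succ m => exact (hx' m (by omega)).2
  have hlast := dp_mul_dp (E (m + 1) (m + 1)) (f (m + 1) - tup (m + 1) x m) (e (m + 1))
  rw [show e (m + 1) + (f (m + 1) - tup (m + 1) x m) =
    e (m + 1) + f (m + 1) - tup (m + 1) x m by omega] at hlast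
  rw [hlist, dp_mul_prod_eq_smul_prod e f (tup (m + 1) x) m (tup_zero (n := m + 1) x) hx',
    smul_mul_assoc, mul_assoc, hlast, mul_smul_comm, smul_smul, List.prod_range_succ]
  simp only [Nat.add_sub_cancel, tup_self, Nat.sub_zero, dp_zero, mul_one]
  congr 1
  rw [zpow_neg, zpow_natCast, ← inv_pow, mul_assoc, prod_Icc_eq_prod_range, sum_Icc_eq_sum_range,
    Finset.prod_range_succ]
  simp only [Nat.add_sub_cancel, tup_self, Nat.sub_zero]

end
end
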